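/- In the case N = 1 (one field component), the multisymplectic classification includes the extra term: X is locally hamiltonian for ω on ℝ^{2(n+1)} with coordinates (x^μ, q, p^μ, p) iff X^μ and X^q are independent of (p^κ, p) and there exist f_0^μ(x,q) with X_{p^μ} = − p ∂X^μ/∂q − p^μ ∂X^q/∂q + p^ν ∂X^μ/∂x^ν − p^μ ∂X^ν/∂x^ν + ∂f_0^μ/∂q and X_0 = − p ∂X^μ/∂x^μ − p^μ ∂X^q/∂x^μ + ∂f_0^μ/∂x^μ; in particular X^μ may depend on q when N = 1. -/

import Mathlib

open scoped BigOperators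

namespace MPS

variable (n N : ℕ)

/-- The multiphase space with base dimension `n+2` and `N` field components:
coordinates `(x^μ, q^i, p_i^μ, p)`. -/
abbrev Pt := (Fin (n+2) → ℝ) × (Fin N → ℝ) × (Fin N → Fin (n+2) → ℝ) × ℝ

/-- A `k`-form on `Pt`, represented by its values on `k`-tuples of (constant) vectors. -/
abbrev Form (k : ℕ) := Pt n N → (Fin k → Pt n N) → ℝ

/-- The covector `dx^μ`. -/
def cx (μ : Fin (n+2)) : Pt n N → ℝ := fun z => z.1 μ
/-- The covector `dq^i`. -/
def cq (i : Fin N) : Pt n N → ℝ := fun z => z.2.1 i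
/-- The covector `dp_i^μ`. -/
def cp (i : Fin N) (μ : Fin (n+2)) : Pt n N → ℝ := fun z => z.2.2.1 i μ
/-- The covector `dp` (energy). -/
def cE : Pt n N → ℝ := fun z => z.2.2.2

/-- The coordinate vector `∂/∂x^μ`. -/
def ex (μ : Fin (n+2)) : Pt n N := (Pi.single μ 1, 0, 0, 0)
/-- The coordinate vector `∂/∂q^i`. -/
def eq (i : Fin N) : Pt n N := (0, Pi.single i 1, 0, 0)
/-- The coordinate vector `∂/∂p_i^μ`. -/
def ep (i : Fin N) (μ : Fin (n+2)) : Pt n N := (0, 0, Pi.single i (Pi.single μ 1), 0)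
/-- The coordinate vector `∂/∂p`. -/
def eE : Pt n N := (0, 0, 0, 1)

/-- Wedge of a (constant-coefficient) 1-form with a `k`-form. -/
def wedge1 {k : ℕ} (α : Pt n N → ℝ) (β : (Fin k → Pt n N) → ℝ) :
    (Fin (k+1) → Pt n N) → ℝ :=
  fun v => ∑ j : Fin (k+1), (-1 : ℝ) ^ (j : ℕ) * α (v j) * β (v ∘ j.succAbove)

/-- The volume covector `d^n x = dx^1 ∧ … ∧ dx^n`. -/
def vol : (Fin (n+2) → Pt n N) → ℝ :=
  fun v => Matrix.det (Matrix.of fun a b => (v b).1 a)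

/-- `d^n x_μ = i_{∂_μ} d^n x`. -/
def volm (μ : Fin (n+2)) : (Fin (n+1) → Pt n N) → ℝ :=
  fun v => vol n N (Fin.cons (ex n N μ) v)

/-- The canonical multisymplectic form
`ω = dq^i ∧ dp_i^μ ∧ d^n x_μ − dp ∧ d^n x`. -/
def omega : Form n N (n+3) :=
  fun _ v =>
    (∑ i : Fin N, ∑ μ : Fin (n+2),
      wedge1 n N (cq n N i) (wedge1 n N (cp n N i μ) (volm n N μ)) v)
    - wedge1 n N (cE n N) (vol n N) v

/-- The multicanonical form `θ = p_i^μ dq^i ∧ d^n x_μ + p d^n x`. -/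
def theta : Form n N (n+2) :=
  fun z v =>
    (∑ i : Fin N, ∑ μ : Fin (n+2),
      z.2.2.1 i μ * wedge1 n N (cq n N i) (volm n N μ) v)
    + z.2.2.2 * vol n N v

/-- Exterior derivative of a `k`-form on the vector space `Pt`. -/
noncomputable def extd {k : ℕ} (ω : Form n N k) : Form n N (k+1) :=
  fun x v => ∑ j : Fin (k+1), (-1 : ℝ) ^ (j : ℕ) *
    fderiv ℝ (fun y => ω y (v ∘ j.succAbove)) x (v j)

/-- Interior product of a vector field with a `(k+1)`-form. -/
def iVF {k : ℕ} (X : Pt n N → Pt n N) (ω : Form n N (k+1)) : Form n N k :=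
  fun x v => ω x (Fin.cons (X x) v)

/-- Lie derivative of a `(k+1)`-form along a vector field (Cartan's formula). -/
noncomputable def lieD {k : ℕ} (X : Pt n N → Pt n N) (ω : Form n N (k+1)) : Form n N (k+1) :=
  fun x v => extd n N (iVF n N X ω) x v + iVF n N X (extd n N ω) x v

/-- Lie bracket of vector fields on `Pt`. -/
noncomputable def lieB (X Y : Pt n N → Pt n N) : Pt n N → Pt n N :=
  fun z => fderiv ℝ Y z (X z) - fderiv ℝ X z (Y z)

/-- `d^n x_{μν} = i_{∂_ν} i_{∂_μ} d^n x`. -/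
def volmn (μ ν : Fin (n+2)) : (Fin n → Pt n N) → ℝ :=
  fun v => vol n N (Fin.cons (ex n N μ) (Fin.cons (ex n N ν) v))

/-- Partial derivative `∂f/∂x^μ`. -/
noncomputable def pdx (f : Pt n N → ℝ) (z : Pt n N) (μ : Fin (n+2)) : ℝ :=
  fderiv ℝ f z (ex n N μ)

/-- Partial derivative `∂f/∂q^i`. -/
noncomputable def pdq (f : Pt n N → ℝ) (z : Pt n N) (i : Fin N) : ℝ :=
  fderiv ℝ f z (eq n N i)

/-- Partial derivative `∂f/∂p_i^μ`. -/
noncomputable def pdp (f : Pt n N → ℝ) (z : Pt n N) (i : Fin N) (μ : Fin (n+2)) : ℝ :=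
  fderiv ℝ f z (ep n N i μ)

/-- Partial derivative `∂f/∂p`. -/
noncomputable def pdE (f : Pt n N → ℝ) (z : Pt n N) : ℝ :=
  fderiv ℝ f z (eE n N)

end MPS

namespace MPS

/-- The space of `(q, x)` values. -/
abbrev EE (n : ℕ) := Fin (n+3) → ℝ

/-- Projection to `(q, x)`. -/
noncomputable def yy (n : ℕ) : Pt n 1 →L[ℝ] EE n :=
  LinearMap.toContinuousLinearMap
    { toFun := fun z => Fin.cons (z.2.1 0) z.1
      map_add' := by
        intro a b; ext i; refine Fin.cases ?_ (fun j => ?_) i <;> simp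
      map_smul' := by
        intro a b; ext i; refine Fin.cases ?_ (fun j => ?_) i <;> simp }

/-- Projection to the momenta `(p, -p^μ)`. -/
noncomputable def pp (n : ℕ) : Pt n 1 →L[ℝ] EE n :=
  LinearMap.toContinuousLinearMap
    { toFun := fun z => Fin.cons (z.2.2.2) (fun μ => - z.2.2.1 0 μ)
      map_add' := by
        intro a b; ext i; refine Fin.cases ?_ (fun j => ?_) i <;> simp; ring
      map_smul' := by
        intro a b; ext i; refine Fin.cases ?_ (fun j => ?_) i <;> simp }

/-- Inclusion of `(q, x)`. -/
noncomputable def iy (n : ℕ) : EE n →L[ℝ] Pt n 1 :=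
  LinearMap.toContinuousLinearMap
    { toFun := fun s => (fun μ => s μ.succ, fun _ => s 0, 0, 0)
      map_add' := by
        intro a b; ext <;> simp
      map_smul' := by
        intro a b; ext <;> simp }

/-- Inclusion of the momenta. -/
noncomputable def ip (n : ℕ) : EE n →L[ℝ] Pt n 1 :=
  LinearMap.toContinuousLinearMap
    { toFun := fun s => (0, 0, fun _ μ => - s μ.succ, s 0)
      map_add' := by
        intro a b; ext <;> simp; ring
      map_smul' := by
        intro a b; ext <;> simp }

lemma yy_apply (n : ℕ) (z : Pt n 1) : yy n z = Fin.cons (z.2.1 0) z.1 := rfl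
lemma pp_apply (n : ℕ) (z : Pt n 1) :
    pp n z = Fin.cons (z.2.2.2) (fun μ => - z.2.2.1 0 μ) := rfl
lemma iy_apply (n : ℕ) (s : EE n) : iy n s = (fun μ => s μ.succ, fun _ => s 0, 0, 0) := rfl
lemma ip_apply (n : ℕ) (s : EE n) : ip n s = (0, 0, fun _ μ => - s μ.succ, s 0) := rfl

@[simp] lemma yy_iy (n : ℕ) (s : EE n) : yy n (iy n s) = s := by
  ext i; refine Fin.cases ?_ (fun j => ?_) i <;> simp [yy_apply, iy_apply]
@[simp] lemma pp_ip (n : ℕ) (s : EE n) : pp n (ip n s) = s := by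
  ext i; refine Fin.cases ?_ (fun j => ?_) i <;> simp [pp_apply, ip_apply]
@[simp] lemma yy_ip (n : ℕ) (s : EE n) : yy n (ip n s) = 0 := by
  ext i; refine Fin.cases ?_ (fun j => ?_) i <;> simp [yy_apply, ip_apply]
@[simp] lemma pp_iy (n : ℕ) (s : EE n) : pp n (iy n s) = 0 := by
  ext i; refine Fin.cases ?_ (fun j => ?_) i <;> simp [pp_apply, iy_apply]
lemma decomp (n : ℕ) (z : Pt n 1) : iy n (yy n z) + ip n (pp n z) = z := by
  ext i j
  · simp [iy_apply, ip_apply, yy_apply, pp_apply]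
  · have : i = 0 := Subsingleton.elim _ _
    simp [iy_apply, ip_apply, yy_apply, pp_apply, this]
  · have : i = 0 := Subsingleton.elim _ _
    simp [iy_apply, ip_apply, yy_apply, pp_apply, this]
  · simp [iy_apply, ip_apply, yy_apply, pp_apply]

/-- The determinant as an alternating map of its rows. -/
noncomputable def dd (m : ℕ) : (Fin m → ℝ) [⋀^Fin m]→ₗ[ℝ] ℝ := Matrix.detRowAlternating

lemma dd_eq {m : ℕ} (w : Fin m → Fin m → ℝ) : dd m w = Matrix.det (Matrix.of w) := rfl

lemma dd_update {m : ℕ} (w : Fin m → Fin m → ℝ) (j : Fin m) (u : Fin m → ℝ) :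
    dd m (Function.update w j u) = ∑ l, u l * Matrix.adjugate (Matrix.of w) l j := by
  have h0 : Matrix.of (Function.update w j u) = Matrix.updateRow (Matrix.of w) j u := rfl
  rw [dd_eq, h0, ← Matrix.cramer_transpose_apply,
    Matrix.cramer_eq_adjugate_mulVec, ← Matrix.adjugate_transpose]
  simp [Matrix.mulVec, dotProduct, mul_comm]

/-- Trace derivation identity for the determinant. -/
lemma det_trace {m : ℕ} (a : (Fin m → ℝ) →ₗ[ℝ] (Fin m → ℝ)) (w : Fin m → Fin m → ℝ) :
    ∑ j, dd m (Function.update w j (a (w j))) =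
      (∑ i, a (Pi.single i 1) i) * dd m w := by
  have h2 : ∀ j l, a (w j) l = ∑ i, w j i * a (Pi.single i 1) l := by
    intro j l
    conv_lhs => rw [show w j = ∑ i, w j i • (Pi.single i (1:ℝ) : Fin m → ℝ) from by
      ext k; simp [Finset.sum_apply, Pi.single_apply]]
    simp [Finset.sum_apply]
  have h3 : ∀ l i, ∑ j, Matrix.adjugate (Matrix.of w) l j * w j i = if l = i then dd m w else 0 := by
    intro l i
    have := congrFun (congrFun (Matrix.adjugate_mul (Matrix.of w)) l) i
    rw [Matrix.mul_apply] at this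
    simp only [Matrix.of_apply] at this
    rw [this, dd_eq]; simp [Matrix.one_apply]
  calc ∑ j, dd m (Function.update w j (a (w j)))
      = ∑ j, ∑ l, ∑ i, w j i * a (Pi.single i 1) l * Matrix.adjugate (Matrix.of w) l j := by
        simp_rw [dd_update, h2, Finset.sum_mul]
    _ = ∑ l, ∑ i, a (Pi.single i 1) l * ∑ j, Matrix.adjugate (Matrix.of w) l j * w j i := by
        rw [Finset.sum_comm]
        refine Finset.sum_congr rfl fun l _ => ?_
        rw [Finset.sum_comm]
        refine Finset.sum_congr rfl fun i _ => ?_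
        rw [Finset.mul_sum]
        refine Finset.sum_congr rfl fun j _ => ?_
        ring
    _ = _ := by
        simp_rw [h3]
        simp [Finset.sum_mul]

/-- The unit frame. -/
def fr (m : ℕ) : Fin m → Fin m → ℝ := fun i => Pi.single i 1

lemma of_fr {m : ℕ} : Matrix.of (fr m) = 1 := by
  ext i j; simp [fr, Matrix.one_apply, Pi.single_apply, eq_comm]

lemma det_fr {m : ℕ} : dd m (fr m) = 1 := by
  rw [dd_eq, of_fr]; simp

lemma det_fr_update {m : ℕ} (k : Fin m) (u : Fin m → ℝ) :
    dd m (Function.update (fr m) k u) = u k := by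
  rw [dd_update, of_fr]; simp [Matrix.one_apply]

/-- The determinantal model of `ω`. -/
noncomputable def Om (n : ℕ) : MultilinearMap ℝ (fun _ : Fin (n+3) => Pt n 1) ℝ :=
  - ∑ k : Fin (n+3), (dd (n+3)).toMultilinearMap.compLinearMap
    (fun i => if i = k then (pp n : Pt n 1 →ₗ[ℝ] EE n) else (yy n : Pt n 1 →ₗ[ℝ] EE n))

lemma Om_apply (n : ℕ) (v : Fin (n+3) → Pt n 1) :
    Om n v = - ∑ k, dd (n+3) (Function.update (fun i => yy n (v i)) k (pp n (v k))) := by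
  simp only [Om, neg_apply, sum_apply,
    MultilinearMap.compLinearMap_apply]
  congr 1
  refine Finset.sum_congr rfl fun k _ => ?_
  show dd (n+3) _ = _
  congr 1
  ext i j
  by_cases h : i = k
  · subst h; simp
  · simp [h]

lemma Om_perm (n : ℕ) (v : Fin (n+3) → Pt n 1) (σ : Equiv.Perm (Fin (n+3))) :
    Om n (v ∘ σ) = (Equiv.Perm.sign σ : ℤ) • Om n v := by
  rw [Om_apply, Om_apply, smul_neg, Finset.smul_sum]
  congr 1
  rw [← Equiv.sum_comp σ (fun k => (Equiv.Perm.sign σ : ℤ) • _)]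
  refine Finset.sum_congr rfl fun k _ => ?_
  refine Eq.trans ?_ (AlternatingMap.map_perm _ _ σ)
  congr 1
  ext i j
  by_cases h : i = k
  · subst h; simp
  · have : σ i ≠ σ k := fun h' => h (σ.injective h')
    simp [h, this]

lemma Om_cons (n : ℕ) (v : Fin (n+3) → Pt n 1) (j : Fin (n+3)) (a : Pt n 1) :
    (-1 : ℝ) ^ (j : ℕ) * Om n (Fin.cons a (v ∘ j.succAbove)) = Om n (Function.update v j a) := by
  have h : Function.update v j a
      = (Fin.cons a (v ∘ j.succAbove) : Fin (n+3) → Pt n 1) ∘ j.cycleRange := by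
    rw [Fin.cons_comp_cycleRange]
    ext1 i
    refine Fin.succAboveCases j ?_ (fun i => ?_) i <;> simp [Fin.succAbove_ne]
  rw [h, Om_perm, Fin.sign_cycleRange]
  simp
lemma volm_sum (n : ℕ) (w : Fin (n+2) → Pt n 1) :
    ∑ μ, wedge1 n 1 (cp n 1 0 μ) (volm n 1 μ) w =
      ∑ i, dd (n+2) (Function.update (fun j => (w j).1) i ((w i).2.2.1 0)) := by
  unfold wedge1
  rw [Finset.sum_comm]
  refine Finset.sum_congr rfl fun i _ => ?_
  have h1 : ∀ u : Fin (n+2) → ℝ, dd (n+2) (Function.update (fun j => (w j).1) i u) =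
      (-1 : ℝ) ^ (i : ℕ) * dd (n+2) (Fin.cons u (fun j => (w (i.succAbove j)).1)) := by
    intro u
    have h : Function.update (fun j => (w j).1) i u =
        (Fin.cons u (fun j => (w (i.succAbove j)).1) : Fin (n+2) → Fin (n+2) → ℝ)
          ∘ i.cycleRange := by
      rw [Fin.cons_comp_cycleRange]
      ext1 j
      refine Fin.succAboveCases i ?_ (fun i => ?_) j <;> simp [Fin.succAbove_ne]
    rw [h]
    rw [AlternatingMap.map_perm, Fin.sign_cycleRange]
    simp [Units.smul_def]
  have h2 : ∀ μ, volm n 1 μ (w ∘ i.succAbove) =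
      dd (n+2) (Fin.cons (Pi.single μ 1) (fun j => (w (i.succAbove j)).1)) := by
    intro μ
    unfold volm vol
    rw [dd_eq, ← Matrix.det_transpose]
    congr 1
    ext a b
    refine Fin.cases ?_ (fun a => ?_) a <;> simp [ex]
  rw [h1]
  simp only [h2, cp]
  have h3 : dd (n+2) (Fin.cons ((w i).2.2.1 0) (fun j => (w (i.succAbove j)).1)) =
      ∑ μ, (w i).2.2.1 0 μ *
        dd (n+2) (Fin.cons (Pi.single μ 1) (fun j => (w (i.succAbove j)).1)) := by
    have h4 : ∀ u : Fin (n+2) → ℝ, (Fin.cons u (fun j => (w (i.succAbove j)).1) : Fin (n+2) → Fin (n+2) → ℝ)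
      = Function.update (Fin.cons 0 (fun j => (w (i.succAbove j)).1) : Fin (n+2) → Fin (n+2) → ℝ) 0 u := by
      intro u; simp
    have h5 : (w i).2.2.1 0 = ∑ μ, (w i).2.2.1 0 μ • (Pi.single μ (1:ℝ) : Fin (n+2) → ℝ) := by
      ext k; simp [Finset.sum_apply, Pi.single_apply]
    set P := (w i).2.2.1 0
    set B := (Fin.cons 0 (fun j => (w (i.succAbove j)).1) : Fin (n+2) → Fin (n+2) → ℝ)
    have h6 : ∀ u : Fin (n+2) → ℝ, dd (n+2) (Fin.cons u (fun j => (w (i.succAbove j)).1)) =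
        (dd (n+2)).toMultilinearMap.toLinearMap B 0 u := by
      intro u
      rw [h4]; rfl
    simp only [h6]
    conv_lhs => rw [h5]
    simp
  rw [h3, Finset.mul_sum]
  refine Finset.sum_congr rfl fun μ _ => ?_
  ring

lemma omega_eq (n : ℕ) (z : Pt n 1) (v : Fin (n+3) → Pt n 1) : omega n 1 z v = Om n v := by
  have hA : ∑ i : Fin 1, ∑ μ : Fin (n+2),
      wedge1 n 1 (cq n 1 i) (wedge1 n 1 (cp n 1 i μ) (volm n 1 μ)) v =
      ∑ j : Fin (n+3), (-1 : ℝ) ^ (j : ℕ) * (v j).2.1 0 *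
        ∑ i, dd (n+2) (Function.update (fun l => (v (j.succAbove l)).1) i
          ((v (j.succAbove i)).2.2.1 0)) := by
    rw [Fin.sum_univ_one]
    have : ∀ j : Fin (n+3), ∑ i, dd (n+2) (Function.update (fun l => (v (j.succAbove l)).1) i
          ((v (j.succAbove i)).2.2.1 0)) =
          ∑ μ, wedge1 n 1 (cp n 1 0 μ) (volm n 1 μ) (v ∘ j.succAbove) := by
      intro j; rw [volm_sum]; rfl
    simp only [this, Finset.mul_sum]
    rw [Finset.sum_comm]
    rfl
  have hB : ∀ k, dd (n+3) (Function.update (fun i => yy n (v i)) k (pp n (v k))) =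
      ∑ j : Fin (n+3), (-1 : ℝ) ^ (j : ℕ) *
        (Function.update (fun i => yy n (v i)) k (pp n (v k)) j 0) *
        dd (n+2) (fun i l => Function.update (fun i => yy n (v i)) k (pp n (v k))
          (j.succAbove i) (Fin.succ l)) := by
    intro k
    rw [dd_eq, Matrix.det_succ_column_zero]
    rfl
  have hC : ∀ j k : Fin (n+3), (-1 : ℝ) ^ (j : ℕ) *
        (Function.update (fun i => yy n (v i)) k (pp n (v k)) j 0) *
        dd (n+2) (fun i l => Function.update (fun i => yy n (v i)) k (pp n (v k))
          (j.succAbove i) (Fin.succ l)) = 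
      if h : j = k then (-1 : ℝ) ^ (j : ℕ) * (v j).2.2.2 * vol n 1 (v ∘ j.succAbove)
      else (-1 : ℝ) ^ (j : ℕ) * (v j).2.1 0 *
        dd (n+2) (fun i l => Function.update (fun i => yy n (v i)) k (pp n (v k))
          (j.succAbove i) (Fin.succ l)) := by
    intro j k
    split_ifs with h
    · subst h
      congr 1
      · simp [pp_apply]
      · unfold vol
        rw [dd_eq, ← Matrix.det_transpose]
        congr 1
        ext a b
        simp [Fin.succAbove_ne, yy_apply]
    · simp [h, yy_apply]
  have hD : ∀ (j : Fin (n+3)) (i : Fin (n+2)), dd (n+2) (fun i' l => Function.update (fun i => yy n (v i)) (j.succAbove i)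
        (pp n (v (j.succAbove i))) (j.succAbove i') (Fin.succ l)) =
      - dd (n+2) (Function.update (fun l => (v (j.succAbove l)).1) i
          ((v (j.succAbove i)).2.2.1 0)) := by
    intro j i
    have : (fun i' l => Function.update (fun i => yy n (v i)) (j.succAbove i)
        (pp n (v (j.succAbove i))) (j.succAbove i') (Fin.succ l)) =
        Function.update (fun l => (v (j.succAbove l)).1) i
          ((-1 : ℝ) • ((v (j.succAbove i)).2.2.1 0)) := by
      ext i' l
      by_cases h : i' = i
      · subst h; simp [pp_apply]
      · simp [h, yy_apply]
    rw [this]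
    rw [AlternatingMap.map_update_smul]
    simp
  rw [Om_apply]
  unfold omega
  rw [hA]
  simp only [hB, hC]
  rw [Finset.sum_comm]
  have hE : ∀ j : Fin (n+3), (∑ k : Fin (n+3), if h : j = k then (-1 : ℝ) ^ (j : ℕ) * (v j).2.2.2 * vol n 1 (v ∘ j.succAbove)
      else (-1 : ℝ) ^ (j : ℕ) * (v j).2.1 0 *
        dd (n+2) (fun i l => Function.update (fun i => yy n (v i)) k (pp n (v k))
          (j.succAbove i) (Fin.succ l))) = 
      (-1 : ℝ) ^ (j : ℕ) * (v j).2.2.2 * vol n 1 (v ∘ j.succAbove)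
      - (-1 : ℝ) ^ (j : ℕ) * (v j).2.1 0 *
        ∑ i, dd (n+2) (Function.update (fun l => (v (j.succAbove l)).1) i
          ((v (j.succAbove i)).2.2.1 0)) := by
    intro j
    rw [Fin.sum_univ_succAbove _ j]
    simp only [dite_true, (Fin.succAbove_ne j _).symm, dite_false, hD]
    simp [Finset.mul_sum, sub_eq_add_neg]
  simp only [hE, Finset.sum_sub_distrib]
  unfold wedge1 cE
  ring

lemma lieD_eq (n : ℕ) (X : Pt n 1 → Pt n 1) (hX : Differentiable ℝ X) (z : Pt n 1)
    (v : Fin (n+3) → Pt n 1) :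
    lieD n 1 X (omega n 1) z v = ∑ j, Om n (Function.update v j (fderiv ℝ X z (v j))) := by
  unfold lieD
  have h0 : iVF n 1 X (extd n 1 (omega n 1)) z v = 0 := by
    unfold iVF extd
    simp [omega_eq]
  rw [h0, add_zero]
  unfold extd iVF
  refine Finset.sum_congr rfl fun j _ => ?_
  rw [← Om_cons]
  congr 1
  simp only [omega_eq]
  have : ∀ a : Pt n 1, Om n (Fin.cons a (v ∘ j.succAbove)) =
      LinearMap.toContinuousLinearMap ((Om n).toLinearMap (Fin.cons 0 (v ∘ j.succAbove)) 0) a := by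
    intro a; simp
  simp only [this]
  have h := ((LinearMap.toContinuousLinearMap
    ((Om n).toLinearMap (Fin.cons 0 (v ∘ j.succAbove)) 0)).hasFDerivAt.comp z
      (hX z).hasFDerivAt).fderiv
  exact congrArg (fun L => L (v j)) h
/-- The trace of the base block. -/
noncomputable def trA (n : ℕ) (A : Pt n 1 →L[ℝ] Pt n 1) : ℝ :=
  ∑ i, yy n (A (iy n (Pi.single i 1))) i

/-- The infinitesimal symmetry conditions. -/
def Cond (n : ℕ) (A : Pt n 1 →L[ℝ] Pt n 1) : Prop :=
  (∀ u, yy n (A (ip n u)) = 0) ∧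
  (∀ u, pp n (A (ip n u)) = yy n (A (iy n u)) - trA n A • u) ∧
  ∑ i, pp n (A (iy n (Pi.single i 1))) i = 0

/-- Rows of the elementary terms. -/
noncomputable def RR (n : ℕ) (A : Pt n 1 →L[ℝ] Pt n 1) (v : Fin (n+3) → Pt n 1) (j k : Fin (n+3)) :
    Fin (n+3) → EE n := fun i =>
  if i = k then (if i = j then pp n (A (v i)) else pp n (v i))
  else (if i = j then yy n (A (v i)) else yy n (v i))

lemma sum_Om (n : ℕ) (A : Pt n 1 →L[ℝ] Pt n 1) (v : Fin (n+3) → Pt n 1) :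
    ∑ j, Om n (Function.update v j (A (v j))) = - ∑ k, ∑ j, dd (n+3) (RR n A v j k) := by
  simp only [Om_apply, Finset.sum_neg_distrib]
  rw [Finset.sum_comm]
  congr 1
  refine Finset.sum_congr rfl fun k _ => Finset.sum_congr rfl fun j _ => ?_
  congr 1
  ext1 i
  unfold RR
  by_cases h1 : i = k <;> by_cases h2 : i = j
  · subst h1; subst h2; simp
  · subst h1; simp [h2]
  · subst h2; simp [h1]
  · simp [h1, h2]

lemma exists_third (n : ℕ) (k s : Fin (n+3)) : ∃ j, j ≠ k ∧ j ≠ s := by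
  by_contra! h
  have h1 : (Finset.univ : Finset (Fin (n+3))) ⊆ {k, s} := by
    intro j _
    by_cases hj : j = k
    · simp [hj]
    · simp [h j hj]
  have h2 := Finset.card_le_card h1
  have h3 := Finset.card_le_two (a := k) (b := s)
  simp at h2
  omega

lemma cond_of (n : ℕ) (A : Pt n 1 →L[ℝ] Pt n 1)
    (H : ∀ v : Fin (n+3) → Pt n 1, ∑ k, ∑ j, dd (n+3) (RR n A v j k) = 0) : Cond n A := by
  have key : ∀ (j0 k0 : Fin (n+3)) (u : EE n), j0 ≠ k0 →
      yy n (A (ip n u)) k0 + dd (n+3) (Function.update (Function.update (fr (n+3)) k0 u) j0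
        (yy n (A (ip n (Pi.single j0 1))))) = 0 := by
    intro j0 k0 u hne
    have h := H (fun i => if i = j0 then ip n (Pi.single j0 1) else if i = k0 then ip n u
      else iy n (Pi.single i 1))
    set v : Fin (n+3) → Pt n 1 := (fun i => if i = j0 then ip n (Pi.single j0 1) else
      if i = k0 then ip n u else iy n (Pi.single i 1)) with hv
    have vj : v j0 = ip n (Pi.single j0 1) := by simp [hv]
    have vk : v k0 = ip n u := by simp [hv, hne.symm]
    have z1 : ∀ j k, j0 ≠ j → j0 ≠ k → dd (n+3) (RR n A v j k) = 0 := by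
      intro j k h1 h2
      refine AlternatingMap.map_coord_zero _ j0 ?_
      simp [RR, h1, h2, vj]
    have z2 : ∀ j k, k0 ≠ j → k0 ≠ k → dd (n+3) (RR n A v j k) = 0 := by
      intro j k h1 h2
      refine AlternatingMap.map_coord_zero _ k0 ?_
      simp [RR, h1, h2, vk]
    rw [Fintype.sum_eq_add j0 k0 hne, Fintype.sum_eq_single k0, Fintype.sum_eq_single j0] at h
    · rw [← h]
      congr 1
      · rw [← det_fr_update k0 (yy n (A (ip n u)))]
        congr 1
        ext1 i
        by_cases h1 : i = j0
        · subst h1; simp [RR, hne, vj, fr]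
        · by_cases h2 : i = k0
          · subst h2; simp [RR, hne.symm, vk]
          · simp [RR, h1, h2, hv, fr]
      · congr 1
        ext1 i
        by_cases h1 : i = j0
        · subst h1; simp [RR, hne, vj]
        · by_cases h2 : i = k0
          · subst h2; simp [RR, hne.symm, vk]
          · simp [RR, h1, h2, hv, fr]
    · intro j hj
      exact z1 j k0 (Ne.symm hj) hne
    · intro j hj
      exact z2 j j0 (Ne.symm hj) hne.symm
    · intro k hk
      refine Finset.sum_eq_zero fun j _ => ?_
      by_cases hj : j0 = j
      · exact z2 j k (by rw [← hj]; exact hne.symm) (Ne.symm hk.2)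
      · exact z1 j k hj (Ne.symm hk.1)
  have off : ∀ k s, s ≠ k → yy n (A (ip n (Pi.single s 1))) k = 0 := by
    intro k s hsk
    obtain ⟨j, hj1, hj2⟩ := exists_third n k s
    have h := key j k (Pi.single s 1) hj1
    rw [AlternatingMap.map_eq_zero_of_eq (i := k) (j := s) _ _ _ (Ne.symm hsk)] at h
    · simpa using h
    · simp [hj1.symm, hj2.symm, hsk, fr]
  have dia : ∀ j k, j ≠ k → yy n (A (ip n (Pi.single k 1))) k +
      yy n (A (ip n (Pi.single j 1))) j = 0 := by
    intro j k hjk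
    have h := key j k (Pi.single k 1) hjk
    have : Function.update (fr (n+3)) k (Pi.single k 1) = fr (n+3) := by
      rw [Function.update_eq_iff]; simp [fr]
    rwa [this, det_fr_update] at h
  have expd : ∀ u : EE n, u = ∑ i, u i • (Pi.single i (1:ℝ) : EE n) := by
    intro u; ext k; simp [Finset.sum_apply, Pi.single_apply]
  have hb : ∀ u, yy n (A (ip n u)) = 0 := by
    have h1 : ∀ s, yy n (A (ip n (Pi.single s 1))) = 0 := by
      intro s
      ext k
      by_cases hsk : s = k
      · subst hsk
        obtain ⟨j, hj, _⟩ := exists_third n s s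
        obtain ⟨l, hl1, hl2⟩ := exists_third n s j
        have e1 := dia j s hj
        have e2 := dia l s hl1
        have e3 := dia l j hl2
        simp only [Pi.zero_apply]
        linarith
      · exact off k s hsk
    intro u
    rw [expd u]
    simp [map_sum, h1]
  refine ⟨hb, ?_, ?_⟩
  · intro u
    ext k0
    have h := H (fun i => if i = k0 then ip n u else iy n (Pi.single i 1))
    set v : Fin (n+3) → Pt n 1 := (fun i => if i = k0 then ip n u else iy n (Pi.single i 1))
      with hv
    have vk : v k0 = ip n u := by simp [hv]
    rw [Fintype.sum_eq_single k0] at h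
    · let a : EE n →ₗ[ℝ] EE n := ((yy n).comp (A.comp (iy n)) : EE n →L[ℝ] EE n)
      have ha : ∀ s, a s = yy n (A (iy n s)) := fun s => rfl
      set w := Function.update (fr (n+3)) k0 u with hw
      have hT : ∀ j, dd (n+3) (RR n A v j k0) = dd (n+3) (Function.update w j (a (w j))) +
          if j = k0 then pp n (A (ip n u)) k0 - yy n (A (iy n u)) k0 else 0 := by
        intro j
        by_cases hj : j = k0
        · subst hj
          rw [if_pos rfl, ha, hw, Function.update_idem, det_fr_update, Function.update_self]
          rw [add_sub_cancel, ← det_fr_update j (pp n _)]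
          congr 1
          ext1 i
          by_cases h1 : i = j
          · subst h1; simp [RR, vk]
          · simp [RR, h1, hv, fr]
        · rw [if_neg hj, add_zero]
          congr 1
          ext1 i
          by_cases h1 : i = k0
          · subst h1; simp [RR, Ne.symm hj, vk, hw]
          · by_cases h2 : i = j
            · subst h2; simp [RR, hj, hv, hw, ha, fr]
            · simp [RR, h1, h2, hv, hw, fr]
      simp only [hT] at h
      rw [Finset.sum_add_distrib, det_trace, hw, det_fr_update] at h
      simp only [ha, Finset.sum_ite_eq', Finset.mem_univ, if_true] at h
      simp only [trA, Pi.sub_apply, Pi.smul_apply, smul_eq_mul]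
      linarith
    · intro k hk
      refine Finset.sum_eq_zero fun j _ => ?_
      refine AlternatingMap.map_coord_zero _ k0 ?_
      simp [RR, hk.symm, vk, hb]
  · have h := H (fun i => iy n (Pi.single i 1))
    rw [← h]
    refine Finset.sum_congr rfl fun k _ => ?_
    rw [Fintype.sum_eq_single k]
    · rw [← det_fr_update k (pp n _)]
      congr 1
      ext1 i
      by_cases h1 : i = k
      · subst h1; simp [RR]
      · simp [RR, h1, fr]
    · intro j hj
      refine AlternatingMap.map_coord_zero _ k ?_
      simp [RR, hj.symm]

lemma of_cond (n : ℕ) (A : Pt n 1 →L[ℝ] Pt n 1) (hA : Cond n A) (v : Fin (n+3) → Pt n 1) :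
    ∑ k, ∑ j, dd (n+3) (RR n A v j k) = 0 := by
  obtain ⟨hb, hd, hc⟩ := hA
  let a : EE n →ₗ[ℝ] EE n := ((yy n).comp (A.comp (iy n)) : EE n →L[ℝ] EE n)
  have ha : ∀ s, a s = yy n (A (iy n s)) := fun s => rfl
  let c : EE n →ₗ[ℝ] EE n := ((pp n).comp (A.comp (iy n)) : EE n →L[ℝ] EE n)
  have hc' : ∀ s, c s = pp n (A (iy n s)) := fun s => rfl
  have hy : ∀ z, yy n (A z) = a (yy n z) := by
    intro z
    conv_lhs => rw [← decomp n z]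
    simp [hb, ha]
  have hp : ∀ z, pp n (A z) = c (yy n z) + (a (pp n z) + (- trA n A) • pp n z) := by
    intro z
    conv_lhs => rw [← decomp n z]
    simp [hd, ha, hc', sub_eq_add_neg]
  have hT : ∀ j k, dd (n+3) (RR n A v j k) =
      dd (n+3) (Function.update (Function.update (fun i => yy n (v i)) k (pp n (v k))) j
        (a (Function.update (fun i => yy n (v i)) k (pp n (v k)) j))) +
      if j = k then dd (n+3) (Function.update (fun i => yy n (v i)) k (c (yy n (v k)))) -
        trA n A * dd (n+3) (Function.update (fun i => yy n (v i)) k (pp n (v k))) else 0 := by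
    intro j k
    by_cases hj : j = k
    · subst hj
      have : RR n A v j j = Function.update (fun i => yy n (v i)) j
          (c (yy n (v j)) + (a (pp n (v j)) + (- trA n A) • pp n (v j))) := by
        ext1 i
        by_cases h1 : i = j
        · subst h1; simp only [RR, if_true, Function.update_self, hp]
        · simp [RR, h1]
      rw [this, AlternatingMap.map_update_add, AlternatingMap.map_update_add,
        AlternatingMap.map_update_smul, if_pos rfl, Function.update_idem, Function.update_self]
      simp only [smul_eq_mul]
      ring
    · rw [if_neg hj, add_zero]
      congr 1
      ext1 i
      by_cases h1 : i = k
      · subst h1; simp [RR, Ne.symm hj]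
      · by_cases h2 : i = j
        · subst h2; simp [RR, hj, hy]
        · simp [RR, h1, h2]
  have hS : ∀ k, ∑ j, dd (n+3) (RR n A v j k) =
      dd (n+3) (Function.update (fun i => yy n (v i)) k (c (yy n (v k)))) := by
    intro k
    simp only [hT]
    rw [Finset.sum_add_distrib, det_trace]
    simp only [ha, Finset.sum_ite_eq', Finset.mem_univ, if_true, trA]
    ring
  simp only [hS]
  rw [det_trace c (fun i => yy n (v i))]
  simp only [hc', hc, zero_mul]

lemma lieD_iff (n : ℕ) (X : Pt n 1 → Pt n 1) (hX : Differentiable ℝ X) :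
    (∀ (z : Pt n 1) (v : Fin (n+3) → Pt n 1), lieD n 1 X (omega n 1) z v = 0) ↔
      ∀ z, Cond n (fderiv ℝ X z) := by
  simp only [lieD_eq n X hX, sum_Om, neg_eq_zero]
  exact ⟨fun h z => cond_of n _ (h z), fun h z v => of_cond n _ (h z) v⟩
lemma fderiv_coord {E : Type} [NormedAddCommGroup E] [NormedSpace ℝ E] {m : ℕ}
    (F : E → Fin m → ℝ) (s : E) (hF : DifferentiableAt ℝ F s) (i : Fin m) (v : E) :
    fderiv ℝ (fun y => F y i) s v = fderiv ℝ F s v i := by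
  have h := ((ContinuousLinearMap.proj (R := ℝ) (φ := fun _ : Fin m => ℝ) i).hasFDerivAt.comp s
    hF.hasFDerivAt).fderiv
  exact congrArg (fun L => L v) h

lemma fderiv_eq_of_line {E E' : Type} [NormedAddCommGroup E] [NormedSpace ℝ E]
    [NormedAddCommGroup E'] [NormedSpace ℝ E'] (f : E → ℝ) (g : E' → ℝ) (s : E) (s' : E')
    (v : E) (v' : E') (hf : DifferentiableAt ℝ f s) (hg : DifferentiableAt ℝ g s')
    (h : ∀ t : ℝ, f (s + t • v) = g (s' + t • v')) :
    fderiv ℝ f s v = fderiv ℝ g s' v' := by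
  rw [← hf.lineDeriv_eq_fderiv, ← hg.lineDeriv_eq_fderiv, lineDeriv, lineDeriv]
  congr 1
  ext t
  exact h t

lemma param_hasFDerivAt {m : ℕ} (g : (Fin m → ℝ) × ℝ → ℝ) (hg : ContDiff ℝ 1 g) (s : Fin m → ℝ) :
    HasFDerivAt (fun s => ∫ t in (0:ℝ)..1, g (s, t))
      (∫ t in (0:ℝ)..1, (fderiv ℝ g (s, t)).comp (ContinuousLinearMap.inl ℝ (Fin m → ℝ) ℝ)) s := by
  have hc : Continuous (fun x : (Fin m → ℝ) × ℝ =>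
      (fderiv ℝ g x).comp (ContinuousLinearMap.inl ℝ (Fin m → ℝ) ℝ)) :=
    (hg.continuous_fderiv (by simp)).clm_comp continuous_const
  obtain ⟨C, hC⟩ := ((isCompact_closedBall s 1).prod (isCompact_Icc (a := (0:ℝ)) (b := 1))).exists_bound_of_continuousOn
    hc.continuousOn
  refine intervalIntegral.hasFDerivAt_integral_of_dominated_of_fderiv_le
    (F := fun s t => g (s, t)) (bound := fun _ => C)
    (F' := fun s t => (fderiv ℝ g (s, t)).comp (ContinuousLinearMap.inl ℝ (Fin m → ℝ) ℝ))
    (s := Metric.closedBall s 1) (Metric.closedBall_mem_nhds s one_pos) ?_ ?_ ?_ ?_ ?_ ?_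
  · refine Filter.Eventually.of_forall fun x => ?_
    exact (hg.continuous.comp (by fun_prop : Continuous fun t : ℝ => (x, t))).aestronglyMeasurable
  · exact (hg.continuous.comp (by fun_prop : Continuous fun t : ℝ => (s, t))).intervalIntegrable _ _
  · exact (hc.comp (by fun_prop : Continuous fun t : ℝ => (s, t))).aestronglyMeasurable
  · refine Filter.Eventually.of_forall fun t ht x hx => ?_
    refine hC (x, t) ⟨hx, ?_⟩
    rw [Set.uIoc_of_le zero_le_one] at ht
    exact ⟨ht.1.le, ht.2⟩
  · exact intervalIntegrable_const
  · refine Filter.Eventually.of_forall fun t ht x hx => ?_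
    have h1 := (hg.differentiable (by simp) (x, t)).hasFDerivAt
    exact h1.comp x (hasFDerivAt_prodMk_left x t)

lemma param_fderiv {m : ℕ} (g : (Fin m → ℝ) × ℝ → ℝ) (hg : ContDiff ℝ 1 g) (s v : Fin m → ℝ) :
    fderiv ℝ (fun s => ∫ t in (0:ℝ)..1, g (s, t)) s v = ∫ t in (0:ℝ)..1, fderiv ℝ g (s, t) (v, 0) := by
  rw [(param_hasFDerivAt g hg s).fderiv, ContinuousLinearMap.intervalIntegral_apply]
  · simp
  · have hc : Continuous (fun x : (Fin m → ℝ) × ℝ =>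
      (fderiv ℝ g x).comp (ContinuousLinearMap.inl ℝ (Fin m → ℝ) ℝ)) :=
      (hg.continuous_fderiv (by simp)).clm_comp continuous_const
    exact (hc.comp (by fun_prop : Continuous fun t : ℝ => (s, t))).intervalIntegrable _ _

lemma contDiff_dir {E : Type} [NormedAddCommGroup E] [NormedSpace ℝ E] (g : E → ℝ)
    (hg : ContDiff ℝ (⊤ : ℕ∞) g) (v : E) : ContDiff ℝ (⊤ : ℕ∞) (fun x => fderiv ℝ g x v) :=
  (contDiff_infty_iff_fderiv.1 hg).2.clm_apply contDiff_const

lemma param_contDiff {m : ℕ} (k : ℕ) : ∀ (g : (Fin m → ℝ) × ℝ → ℝ), ContDiff ℝ (⊤ : ℕ∞) g →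
    ContDiff ℝ k (fun s => ∫ t in (0:ℝ)..1, g (s, t)) := by
  induction k with
  | zero =>
    intro g hg
    have h1 : ContDiff ℝ 1 g := hg.of_le (by exact_mod_cast le_top)
    simp only [Nat.cast_zero, contDiff_zero]
    exact Differentiable.continuous (𝕜 := ℝ)
      (fun s => (param_hasFDerivAt g h1 s).differentiableAt)
  | succ k ih =>
    intro g hg
    have h1 : ContDiff ℝ 1 g := hg.of_le (by exact_mod_cast le_top)
    push_cast
    rw [contDiff_succ_iff_fderiv_apply]
    refine ⟨fun s => (param_hasFDerivAt g h1 s).differentiableAt, by simp, fun v => ?_⟩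
    simp only [param_fderiv g h1]
    exact ih _ (contDiff_dir g hg (v, 0))

/-- Primitive along the `i`-th coordinate. -/
noncomputable def II {m : ℕ} (i : Fin m) (H : (Fin m → ℝ) → ℝ) (s : Fin m → ℝ) : ℝ :=
  s i * ∫ t in (0:ℝ)..1, H (s + ((t - 1) * s i) • (Pi.single i 1 : Fin m → ℝ))

lemma upd_eq {m : ℕ} (i : Fin m) (s : Fin m → ℝ) (t : ℝ) :
    s + (t - s i) • (Pi.single i 1 : Fin m → ℝ) = Function.update s i t := by
  ext j
  by_cases h : j = i
  · subst h; simp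
  · simp [h]

lemma II_eq {m : ℕ} (i : Fin m) (H : (Fin m → ℝ) → ℝ) (s : Fin m → ℝ) :
    II i H s = ∫ t in (0:ℝ)..(s i), H (Function.update s i t) := by
  have := intervalIntegral.mul_integral_comp_mul_right (a := 0) (b := 1)
    (f := fun t => H (Function.update s i t)) (c := s i)
  rw [zero_mul, one_mul] at this
  rw [← this, II]
  congr 2
  ext t
  rw [← upd_eq]
  ring_nf

lemma II_g_contDiff {m : ℕ} (i : Fin m) (H : (Fin m → ℝ) → ℝ) (hH : ContDiff ℝ (⊤ : ℕ∞) H) :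
    ContDiff ℝ (⊤ : ℕ∞) (fun x : (Fin m → ℝ) × ℝ =>
      H (x.1 + ((x.2 - 1) * x.1 i) • (Pi.single i 1 : Fin m → ℝ))) := by
  refine hH.comp ?_
  fun_prop

lemma II_contDiff {m : ℕ} (i : Fin m) (H : (Fin m → ℝ) → ℝ) (hH : ContDiff ℝ (⊤ : ℕ∞) H) :
    ContDiff ℝ (⊤ : ℕ∞) (II i H) := by
  unfold II
  have h1 := contDiff_infty.2 fun k => param_contDiff k _ (II_g_contDiff i H hH)
  exact (contDiff_apply ℝ ℝ i).mul h1

lemma II_self {m : ℕ} (i : Fin m) (H : (Fin m → ℝ) → ℝ) (hH : ContDiff ℝ (⊤ : ℕ∞) H)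
    (s : Fin m → ℝ) : fderiv ℝ (II i H) s (Pi.single i 1) = H s := by
  have hd : DifferentiableAt ℝ (II i H) s := (II_contDiff i H hH).differentiable (by simp) s
  rw [← hd.lineDeriv_eq_fderiv, lineDeriv]
  have h1 : ∀ t : ℝ, II i H (s + t • (Pi.single i 1 : Fin m → ℝ)) =
      ∫ τ in (0:ℝ)..(s i + t), H (Function.update s i τ) := by
    intro t
    rw [II_eq]
    have h2 : ∀ τ, Function.update (s + t • (Pi.single i 1 : Fin m → ℝ)) i τ =
        Function.update s i τ := by
      intro τ
      ext j
      by_cases h : j = i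
      · subst h; simp
      · simp [h]
    simp [h2]
  simp only [h1]
  have hc : Continuous (fun τ : ℝ => H (Function.update s i τ)) :=
    hH.continuous.comp (continuous_const.update i continuous_id)
  have h3 := (hc.integral_hasStrictDerivAt 0 (s i + 0)).hasDerivAt
  have h4 : HasDerivAt (fun t : ℝ => s i + t) 1 0 := by
    simpa using (hasDerivAt_id (0:ℝ)).const_add (s i)
  have h5 := (h3.comp (0:ℝ) h4).deriv
  simp only [add_zero, mul_one, Function.update_eq_self] at h5
  exact h5

lemma II_other {m : ℕ} (i j : Fin m) (hij : j ≠ i) (H : (Fin m → ℝ) → ℝ)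
    (hH : ContDiff ℝ (⊤ : ℕ∞) H) (s : Fin m → ℝ) :
    fderiv ℝ (II i H) s (Pi.single j 1) = II i (fun x => fderiv ℝ H x (Pi.single j 1)) s := by
  have hg := II_g_contDiff i H hH
  have hg1 : ContDiff ℝ 1 _ := hg.of_le (by exact_mod_cast le_top)
  have h1 : HasFDerivAt (fun s : Fin m → ℝ => s i)
    (ContinuousLinearMap.proj (R := ℝ) (φ := fun _ : Fin m => ℝ) i) s :=
    (ContinuousLinearMap.proj (R := ℝ) (φ := fun _ : Fin m => ℝ) i).hasFDerivAt
  have h2 := h1.mul (param_hasFDerivAt _ hg1 s).differentiableAt.hasFDerivAt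
  have h3 := h2.fderiv
  have h4 := congrArg (fun L => L (Pi.single j 1)) h3
  refine Eq.trans h4 ?_
  simp only [add_apply, smul_apply, smul_eq_mul, ContinuousLinearMap.proj_apply]
  rw [param_fderiv _ hg1, Pi.single_eq_of_ne hij.symm, mul_zero, add_zero, II]
  congr 2
  ext t
  refine fderiv_eq_of_line _ _ _ _ _ _ (hg1.differentiable (by simp) _)
    (hH.differentiable (by simp) _) ?_
  intro τ
  congr 1
  simp [hij.symm]
  abel

lemma poincare (n : ℕ) (F : EE n → EE n) (hF : ContDiff ℝ (⊤ : ℕ∞) F)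
    (hdiv : ∀ s, ∑ i, fderiv ℝ F s (Pi.single i 1) i = 0) :
    ∃ f : EE n → Fin (n+2) → ℝ, ContDiff ℝ (⊤ : ℕ∞) f ∧
      (∀ s μ, fderiv ℝ (fun y => f y μ) s (Pi.single 0 1) = - F s μ.succ) ∧
      (∀ s, ∑ μ, fderiv ℝ (fun y => f y μ) s (Pi.single μ.succ 1) = F s 0) := by
  have hFi : ∀ i, ContDiff ℝ (⊤ : ℕ∞) (fun s => F s i) := fun i => contDiff_pi.1 hF i
  let K : EE n → ℝ := fun s => F (s + (-(s 0)) • (Pi.single 0 1 : EE n)) 0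
  have hK : ContDiff ℝ (⊤ : ℕ∞) K := by
    refine (hFi 0).comp ?_
    fun_prop
  have hK0 : ∀ s, fderiv ℝ K s (Pi.single 0 1) = 0 := by
    intro s
    rw [fderiv_eq_of_line K (fun _ : EE n => K s) s s _ (Pi.single 0 1)
      (hK.differentiable (by simp) _) (differentiableAt_const _)]
    · simp
    · intro t
      simp only [K]
      refine congrFun (congrArg F ?_) 0
      ext k
      refine Fin.cases ?_ (fun k => ?_) k <;> simp
  let f : EE n → Fin (n+2) → ℝ := fun s μ =>
    - II 0 (fun y => F y μ.succ) s + (if μ = 0 then II (1 : Fin (n+3)) K s else 0)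
  have c1 : ∀ μ : Fin (n+2), ContDiff ℝ (⊤ : ℕ∞) (II 0 (fun y => F y μ.succ)) :=
    fun μ => II_contDiff _ _ (hFi _)
  have c2 : ContDiff ℝ (⊤ : ℕ∞) (II (1 : Fin (n+3)) K) := II_contDiff _ _ hK
  have hfd : ∀ s μ v, fderiv ℝ (fun y => f y μ) s v = - fderiv ℝ (II 0 (fun y => F y μ.succ)) s v
      + (if μ = 0 then fderiv ℝ (II (1 : Fin (n+3)) K) s v else 0) := by
    intro s μ v
    have d1 := ((c1 μ).differentiable (by simp) s).hasFDerivAt.neg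
    have d2 := (c2.differentiable (by simp) s).hasFDerivAt
    by_cases hμ : μ = 0
    · simp only [f, hμ, if_true]
      subst hμ
      exact congrArg (fun L => L v) (d1.add d2).fderiv
    · simp only [f, hμ, if_false, add_zero]
      exact congrArg (fun L => L v) d1.fderiv
  refine ⟨f, ?_, ?_, ?_⟩
  · refine contDiff_pi.2 fun μ => ?_
    by_cases hμ : μ = 0
    · simp only [f, hμ, if_true]
      exact (c1 0).neg.add c2
    · simp only [f, hμ, if_false, add_zero]
      exact (c1 μ).neg
  · intro s μ
    rw [hfd, II_self 0 _ (hFi _), II_other 1 0 (by simp) K hK]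
    simp [hK0, II]
  · intro s
    have e1 : ∀ μ : Fin (n+2), fderiv ℝ (II 0 (fun y => F y μ.succ)) s (Pi.single μ.succ 1) =
        ∫ t in (0:ℝ)..(s 0), fderiv ℝ F (Function.update s 0 t) (Pi.single μ.succ 1) μ.succ := by
      intro μ
      rw [II_other 0 μ.succ (Fin.succ_ne_zero _) _ (hFi _), II_eq]
      congr 1
      ext t
      exact fderiv_coord F _ (hF.differentiable (by simp) _) _ _
    have hcF : ∀ i j : Fin (n+3), Continuous fun t : ℝ =>
        fderiv ℝ F (Function.update s 0 t) (Pi.single i 1) j := by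
      intro i j
      have h1 : Continuous (fderiv ℝ F) := hF.continuous_fderiv (by simp)
      have h2 : Continuous fun t : ℝ => Function.update s 0 t :=
        continuous_const.update 0 continuous_id
      exact (continuous_apply j).comp ((h1.comp h2).clm_apply continuous_const)
    simp only [hfd, Finset.sum_add_distrib, Finset.sum_neg_distrib, e1]
    rw [← intervalIntegral.integral_finsetSum
      (fun i _ => (hcF _ _).intervalIntegrable _ _)]
    have e2 : ∀ t : ℝ, ∑ μ : Fin (n+2),
        fderiv ℝ F (Function.update s 0 t) (Pi.single μ.succ 1) μ.succ =
        - fderiv ℝ F (Function.update s 0 t) (Pi.single 0 1) 0 := by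
      intro t
      have := hdiv (Function.update s 0 t)
      rw [Fin.sum_univ_succ] at this
      linarith
    simp only [e2, Finset.sum_ite_eq', Finset.mem_univ, if_true]
    have e3 : fderiv ℝ (II (1 : Fin (n+3)) K) s (Pi.single (Fin.succ 0) 1) = K s :=
      II_self 1 K hK s
    rw [e3]
    have e4 : ∀ t : ℝ, HasDerivAt (fun t : ℝ => F (Function.update s 0 t) 0)
        (fderiv ℝ F (Function.update s 0 t) (Pi.single 0 1) 0) t := by
      intro t
      have h1 := ((hFi 0).differentiable (by simp) (Function.update s 0 t)).hasFDerivAt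
      have h2 := h1.comp_hasDerivAt t (hasDerivAt_update s 0 t)
      rw [fderiv_coord F _ (hF.differentiable (by simp) _)] at h2
      exact h2
    have e5 := intervalIntegral.integral_eq_sub_of_hasDerivAt (a := 0) (b := s 0)
      (fun t _ => e4 t) ((hcF 0 0).intervalIntegrable _ _)
    rw [intervalIntegral.integral_neg, e5]
    have e6 : K s = F (Function.update s 0 0) 0 := by
      simp only [K]
      rw [← upd_eq, zero_sub]
    rw [e6, Function.update_eq_self]
    ring
lemma const_fiber (n : ℕ) (h : EE n → EE n) (hd : Differentiable ℝ h)
    (h0 : ∀ u v, fderiv ℝ h u v = 0) (u : EE n) : h u = h 0 :=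
  is_const_of_fderiv_eq_zero hd (fun u => by ext1 v; exact h0 u v) u 0

/-- The base field. -/
noncomputable def YY (n : ℕ) (X : Pt n 1 → Pt n 1) (s : EE n) : EE n := yy n (X (iy n s))

/-- The divergence of the base field. -/
noncomputable def dv (n : ℕ) (Y : EE n → EE n) (s : EE n) : ℝ :=
  ∑ i, fderiv ℝ Y s (Pi.single i 1) i

/-- The free part of the momentum field. -/
noncomputable def FF (n : ℕ) (f : EE n → Fin (n+2) → ℝ) (s : EE n) : EE n :=
  Fin.cons (∑ μ, fderiv ℝ (fun y => f y μ) s (Pi.single μ.succ 1))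
    (fun μ => - fderiv ℝ (fun y => f y μ) s (Pi.single 0 1))

lemma fderiv_clm_comp {E G K : Type} [NormedAddCommGroup E] [NormedSpace ℝ E]
    [NormedAddCommGroup G] [NormedSpace ℝ G] [NormedAddCommGroup K] [NormedSpace ℝ K]
    (L : G →L[ℝ] K) (X : E → G) (z : E) (hX : DifferentiableAt ℝ X z) (v : E) :
    fderiv ℝ (fun y => L (X y)) z v = L (fderiv ℝ X z v) :=
  congrArg (fun M => M v) (L.hasFDerivAt.comp z hX.hasFDerivAt).fderiv

lemma fderiv_comp_clm {E G K : Type} [NormedAddCommGroup E] [NormedSpace ℝ E]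
    [NormedAddCommGroup G] [NormedSpace ℝ G] [NormedAddCommGroup K] [NormedSpace ℝ K]
    (L : E →L[ℝ] G) (X : G → K) (z : E) (hX : DifferentiableAt ℝ X (L z)) (v : E) :
    fderiv ℝ (fun y => X (L y)) z v = fderiv ℝ X (L z) (L v) :=
  congrArg (fun M => M v) (hX.hasFDerivAt.comp z L.hasFDerivAt).fderiv

lemma fderiv_YY (n : ℕ) (X : Pt n 1 → Pt n 1) (hX : Differentiable ℝ X) (s u : EE n) :
    fderiv ℝ (YY n X) s u = yy n (fderiv ℝ X (iy n s) (iy n u)) := by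
  unfold YY
  rw [fderiv_clm_comp (yy n) (fun y => X (iy n y)) s (hX.comp (iy n).differentiable _),
    fderiv_comp_clm (iy n) X s (hX _)]

lemma YY_contDiff (n : ℕ) (X : Pt n 1 → Pt n 1) (hX : ContDiff ℝ (⊤ : ℕ∞) X) :
    ContDiff ℝ (⊤ : ℕ∞) (YY n X) :=
  (yy n).contDiff.comp (hX.comp (iy n).contDiff)

lemma yy_fderiv (n : ℕ) (X : Pt n 1 → Pt n 1) (hX : ContDiff ℝ (⊤ : ℕ∞) X)
    (hY : ∀ z, yy n (X z) = YY n X (yy n z)) (z w : Pt n 1) :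
    yy n (fderiv ℝ X z w) = fderiv ℝ (YY n X) (yy n z) (yy n w) := by
  rw [← fderiv_clm_comp (yy n) X z (hX.differentiable (by simp) z)]
  simp only [hY]
  rw [fderiv_comp_clm (yy n) (YY n X) z ((YY_contDiff n X hX).differentiable (by simp) _)]

lemma cond_forward (n : ℕ) (X : Pt n 1 → Pt n 1) (hX : ContDiff ℝ (⊤ : ℕ∞) X)
    (hc : ∀ z, Cond n (fderiv ℝ X z)) :
    (∀ z, yy n (X z) = YY n X (yy n z)) ∧ ∃ f : EE n → Fin (n+2) → ℝ, ContDiff ℝ (⊤ : ℕ∞) f ∧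
      ∀ z, pp n (X z) = fderiv ℝ (YY n X) (yy n z) (pp n z) - dv n (YY n X) (yy n z) • pp n z
        + FF n f (yy n z) := by
  have hXd : Differentiable ℝ X := hX.differentiable (by simp)
  have line : ∀ s u : EE n, HasFDerivAt (fun u => X (iy n s + ip n u))
      ((fderiv ℝ X (iy n s + ip n u)).comp (ip n)) u := by
    intro s u
    exact (hXd (iy n s + ip n u)).hasFDerivAt.comp u ((ip n).hasFDerivAt.const_add (iy n s))
  have hY : ∀ z, yy n (X z) = YY n X (yy n z) := by
    intro z
    have hl : ∀ u : EE n, HasFDerivAt (fun u => yy n (X (iy n (yy n z) + ip n u)))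
        ((yy n).comp ((fderiv ℝ X (iy n (yy n z) + ip n u)).comp (ip n))) u :=
      fun u => (yy n).hasFDerivAt.comp u (line _ u)
    have := const_fiber n (fun u => yy n (X (iy n (yy n z) + ip n u)))
      (fun u => (hl u).differentiableAt)
      (fun u v => by rw [(hl u).fderiv]; exact (hc _).1 v) (pp n z)
    simpa [decomp, YY] using this
  refine ⟨hY, ?_⟩
  let F : EE n → EE n := fun s => pp n (X (iy n s))
  have hF : ContDiff ℝ (⊤ : ℕ∞) F := (pp n).contDiff.comp (hX.comp (iy n).contDiff)
  have hFd : ∀ s u, fderiv ℝ F s u = pp n (fderiv ℝ X (iy n s) (iy n u)) := by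
    intro s u
    rw [fderiv_clm_comp (pp n) (fun y => X (iy n y)) s (hXd.comp (iy n).differentiable _),
      fderiv_comp_clm (iy n) X s (hXd _)]
  obtain ⟨f, hf, hf1, hf2⟩ := poincare n F hF (fun s => by simp only [hFd]; exact (hc _).2.2)
  have hFF : ∀ s, FF n f s = F s := by
    intro s
    ext i
    refine Fin.cases ?_ (fun i => ?_) i
    · simp [FF, hf2]
    · simp [FF, hf1]
  refine ⟨f, hf, fun z => ?_⟩
  rw [hFF]
  set s := yy n z with hs
  have hl : ∀ u : EE n, HasFDerivAt (fun u => pp n (X (iy n s + ip n u)) -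
        (fderiv ℝ (YY n X) s u - dv n (YY n X) s • u))
      ((pp n).comp ((fderiv ℝ X (iy n s + ip n u)).comp (ip n)) -
        (fderiv ℝ (YY n X) s - dv n (YY n X) s • ContinuousLinearMap.id ℝ (EE n))) u :=
    fun u => ((pp n).hasFDerivAt.comp u (line _ u)).sub
      ((fderiv ℝ (YY n X) s).hasFDerivAt.sub ((hasFDerivAt_id u).const_smul (dv n (YY n X) s)))
  have := const_fiber n _ (fun u => (hl u).differentiableAt)
      (fun u v => by
        rw [(hl u).fderiv]
        have h1 := (hc (iy n s + ip n u)).2.1 v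
        have h2 : ∀ w, yy n (fderiv ℝ X (iy n s + ip n u) w) =
            fderiv ℝ (YY n X) s (yy n w) := by
          intro w
          rw [yy_fderiv n X hX hY]
          simp
        simp only [h2, trA, yy_iy] at h1
        simp [h1, dv]) (pp n z)
  simp only [hs, decomp, map_zero, add_zero, smul_zero, sub_zero] at this
  simp only [F, hs]
  rw [← this]
  abel

lemma snd_deriv {E G : Type} [NormedAddCommGroup E] [NormedSpace ℝ E]
    [NormedAddCommGroup G] [NormedSpace ℝ G] (h : E → G) (hh : ContDiff ℝ (⊤ : ℕ∞) h) (s v : E) :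
    HasFDerivAt (fun y => fderiv ℝ h y v) ((fderiv ℝ (fderiv ℝ h) s).flip v) s := by
  have h1 : DifferentiableAt ℝ (fderiv ℝ h) s :=
    ((contDiff_infty_iff_fderiv.1 hh).2).differentiable (by simp) s
  have := h1.hasFDerivAt.clm_apply (hasFDerivAt_const v s)
  simpa using this

lemma snd_symm {E G : Type} [NormedAddCommGroup E] [NormedSpace ℝ E]
    [NormedAddCommGroup G] [NormedSpace ℝ G] (h : E → G) (hh : ContDiff ℝ (⊤ : ℕ∞) h) (s v w : E) :
    fderiv ℝ (fderiv ℝ h) s v w = fderiv ℝ (fderiv ℝ h) s w v := by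
  have h1 : IsSymmSndFDerivAt ℝ h s := by
    refine (hh.contDiffAt).isSymmSndFDerivAt ?_
    simp only [minSmoothness_of_isRCLikeNormedField]
    exact WithTop.coe_le_coe.2 (le_top : (2:ℕ∞) ≤ ⊤)
  exact h1 v w

lemma cond_backward (n : ℕ) (X : Pt n 1 → Pt n 1) (hX : ContDiff ℝ (⊤ : ℕ∞) X)
    (hY : ∀ z, yy n (X z) = YY n X (yy n z)) (f : EE n → Fin (n+2) → ℝ)
    (hf : ContDiff ℝ (⊤ : ℕ∞) f)
    (hP : ∀ z, pp n (X z) = fderiv ℝ (YY n X) (yy n z) (pp n z)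
      - dv n (YY n X) (yy n z) • pp n z + FF n f (yy n z)) (z : Pt n 1) :
    Cond n (fderiv ℝ X z) := by
  have hXd : Differentiable ℝ X := hX.differentiable (by simp)
  have hYc := YY_contDiff n X hX
  set Y := YY n X with hYdef
  have hya : ∀ w, yy n (fderiv ℝ X z w) = fderiv ℝ Y (yy n z) (yy n w) := yy_fderiv n X hX hY z
  have hpk : ∀ w k, pp n (fderiv ℝ X z w) k = fderiv ℝ (fun y => pp n (X y) k) z w := by
    intro w k
    rw [fderiv_coord (fun y => pp n (X y)) z ((pp n).differentiableAt.comp z (hXd z)),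
      fderiv_clm_comp (pp n) X z (hXd z)]
  have hpd : ∀ k, DifferentiableAt ℝ (fun y => pp n (X y) k) z := fun k =>
    differentiableAt_pi.1 ((pp n).differentiableAt.comp z (hXd z)) k
  refine ⟨?_, ?_, ?_⟩
  · intro u; rw [hya]; simp
  · intro u
    ext k
    rw [hpk]
    let L : EE n →L[ℝ] ℝ := (ContinuousLinearMap.proj (R := ℝ) (φ := fun _ : Fin (n+3) => ℝ) k).comp
      (fderiv ℝ Y (yy n z) - dv n Y (yy n z) • ContinuousLinearMap.id ℝ (EE n))
    have hL : ∀ v, HasFDerivAt (fun v => L v + FF n f (yy n z) k) L v :=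
      fun v => L.hasFDerivAt.add_const _
    rw [fderiv_eq_of_line _ (fun v => L v + FF n f (yy n z) k) z (pp n z) (ip n u) u (hpd k)
      (hL _).differentiableAt, (hL _).fderiv]
    · simp [L, hya, trA, dv]
    · intro t
      rw [hP]
      simp [L]
      ring
  · have hfμ : ∀ μ, ContDiff ℝ (⊤ : ℕ∞) (fun y => f y μ) := fun μ => contDiff_pi.1 hf μ
    set s := yy n z with hs
    set π := pp n z with hπ
    let D2 := fderiv ℝ (fderiv ℝ Y) s
    -- derivative of the free part
    let FD : Fin (n+3) → EE n → ℝ := fun k v => Fin.cases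
      (∑ μ : Fin (n+2), fderiv ℝ (fderiv ℝ (fun y => f y μ)) s v (Pi.single μ.succ 1))
      (fun μ : Fin (n+2) => - fderiv ℝ (fderiv ℝ (fun y => f y μ)) s v (Pi.single 0 1)) k
    have hFD : ∀ k, DifferentiableAt ℝ (fun y => FF n f y k) s ∧
        ∀ v, fderiv ℝ (fun y => FF n f y k) s v = FD k v := by
      intro k
      refine Fin.cases ?_ (fun μ => ?_) k
      · have h1 : HasFDerivAt (fun y => FF n f y 0)
            (∑ μ : Fin (n+2), (fderiv ℝ (fderiv ℝ (fun y => f y μ)) s).flip (Pi.single μ.succ 1)) s := by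
          simp only [FF, Fin.cons_zero]
          exact HasFDerivAt.fun_sum fun μ _ => snd_deriv _ (hfμ μ) s _
        refine ⟨h1.differentiableAt, fun v => ?_⟩
        rw [h1.fderiv]
        simp [FD]
      · have h1 : HasFDerivAt (fun y => FF n f y μ.succ)
            (-((fderiv ℝ (fderiv ℝ (fun y => f y μ)) s).flip (Pi.single 0 1))) s := by
          simp only [FF, Fin.cons_succ]
          exact (snd_deriv _ (hfμ μ) s _).neg
        refine ⟨h1.differentiableAt, fun v => ?_⟩
        rw [h1.fderiv]
        simp [FD]
    have hFsum : ∑ k, FD k (Pi.single k 1) = 0 := by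
      rw [Fin.sum_univ_succ]
      simp only [FD, Fin.cases_zero, Fin.cases_succ]
      rw [← Finset.sum_add_distrib]
      refine Finset.sum_eq_zero fun μ _ => ?_
      rw [snd_symm _ (hfμ μ)]
      ring
    have hYk : ∀ (v : EE n) (k : Fin (n+3)), HasFDerivAt (fun y => fderiv ℝ Y y v k)
        ((ContinuousLinearMap.proj (R := ℝ) (φ := fun _ : Fin (n+3) => ℝ) k).comp (D2.flip v)) s :=
      fun v k => (ContinuousLinearMap.proj (R := ℝ) (φ := fun _ : Fin (n+3) => ℝ) k).hasFDerivAt.comp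
        s (snd_deriv Y hYc s v)
    have hdv : HasFDerivAt (dv n Y) (∑ i, (ContinuousLinearMap.proj (R := ℝ)
        (φ := fun _ : Fin (n+3) => ℝ) i).comp (D2.flip (Pi.single i 1))) s := by
      unfold dv
      exact HasFDerivAt.fun_sum fun i _ => hYk _ i
    have hterm : ∀ k, pp n (fderiv ℝ X z (iy n (Pi.single k 1))) k =
        D2 (Pi.single k 1) π k - (∑ i, D2 (Pi.single k 1) (Pi.single i 1) i) * π k
          + FD k (Pi.single k 1) := by
      intro k
      have hg := ((hYk π k).sub (hdv.mul_const (π k))).add (hFD k).1.hasFDerivAt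
      rw [hpk, fderiv_eq_of_line _ _ z s (iy n (Pi.single k 1)) (Pi.single k 1) (hpd k)
        hg.differentiableAt, hg.fderiv]
      · simp [(hFD k).2, mul_comm]
      · intro t
        rw [hP]
        simp [hs, hπ]
    simp only [hterm, Finset.sum_add_distrib, Finset.sum_sub_distrib, hFsum, add_zero]
    have e1 : ∑ k, D2 (Pi.single k 1) π k = ∑ k, D2 π (Pi.single k 1) k :=
      Finset.sum_congr rfl fun k _ => by rw [snd_symm Y hYc]
    have e2 : ∀ i, D2 π (Pi.single i 1) i = ∑ k, D2 (Pi.single k 1) (Pi.single i 1) i * π k := by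
      intro i
      have hx : π = ∑ k, π k • (Pi.single k (1:ℝ) : EE n) := by
        ext k; simp [Finset.sum_apply, Pi.single_apply]
      conv_lhs => rw [hx]
      simp [map_sum, Finset.sum_apply, mul_comm]
    rw [e1]
    simp only [e2, Finset.sum_mul]
    rw [Finset.sum_comm]
    simp
lemma yy_ex (n : ℕ) (μ : Fin (n+2)) : yy n (ex n 1 μ) = Pi.single μ.succ 1 := by
  ext i
  refine Fin.cases ?_ (fun i => ?_) i <;> simp [yy_apply, ex, Pi.single_apply]

lemma yy_eq (n : ℕ) : yy n (eq n 1 0) = Pi.single 0 1 := by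
  ext i
  refine Fin.cases ?_ (fun i => ?_) i <;> simp [yy_apply, eq]

lemma yy_ext (n : ℕ) (z w : Pt n 1) : yy n z = yy n w ↔ z.1 = w.1 ∧ z.2.1 = w.2.1 := by
  rw [yy_apply, yy_apply, Fin.cons_inj, and_comm]
  refine and_congr_right fun _ => ⟨fun h => ?_, fun h => by rw [h]⟩
  ext i
  rw [Subsingleton.elim i 0, h]

lemma indep_iff (n : ℕ) (X : Pt n 1 → Pt n 1) :
    (∀ z w : Pt n 1, z.1 = w.1 → z.2.1 = w.2.1 →
          (X z).1 = (X w).1 ∧ (X z).2.1 = (X w).2.1) ↔ ∀ z, yy n (X z) = YY n X (yy n z) := by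
  constructor
  · intro h z
    have h1 := (yy_ext n z (iy n (yy n z))).1 (by simp)
    exact (yy_ext n _ _).2 (h _ _ h1.1 h1.2)
  · intro h z w h1 h2
    rw [← yy_ext, h, h, (yy_ext n z w).2 ⟨h1, h2⟩]

lemma formula_iff (n : ℕ) (X : Pt n 1 → Pt n 1) (hX : ContDiff ℝ (⊤ : ℕ∞) X)
    (hY : ∀ z, yy n (X z) = YY n X (yy n z)) (f : EE n → Fin (n+2) → ℝ)
    (hf : ContDiff ℝ (⊤ : ℕ∞) f) (f0 : Pt n 1 → Fin (n+2) → ℝ) (hf0 : ∀ z, f0 z = f (yy n z))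
    (z : Pt n 1) :
    (pp n (X z) = fderiv ℝ (YY n X) (yy n z) (pp n z)
      - dv n (YY n X) (yy n z) • pp n z + FF n f (yy n z)) ↔
    ((∀ (μ : Fin (n+2)),
           (X z).2.2.1 0 μ =
             - z.2.2.2 * pdq n 1 (fun y => (X y).1 μ) z 0
             - z.2.2.1 0 μ * pdq n 1 (fun y => (X y).2.1 0) z 0
             + (∑ ν : Fin (n+2), z.2.2.1 0 ν * pdx n 1 (fun y => (X y).1 μ) z ν)
             - z.2.2.1 0 μ * (∑ ν : Fin (n+2), pdx n 1 (fun y => (X y).1 ν) z ν)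
             + pdq n 1 (fun y => f0 y μ) z 0) ∧
         ((X z).2.2.2 =
             - z.2.2.2 * (∑ μ : Fin (n+2), pdx n 1 (fun y => (X y).1 μ) z μ)
             - (∑ μ : Fin (n+2), z.2.2.1 0 μ * pdx n 1 (fun y => (X y).2.1 0) z μ)
             + (∑ μ : Fin (n+2), pdx n 1 (fun y => f0 y μ) z μ))) := by
  have hYc := YY_contDiff n X hX
  have hYd : Differentiable ℝ (YY n X) := hYc.differentiable (by simp)
  have hYk : ∀ k w, fderiv ℝ (fun y => yy n (X y) k) z w =
      fderiv ℝ (YY n X) (yy n z) (yy n w) k := by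
    intro k w
    simp only [hY]
    rw [fderiv_coord (fun y => YY n X (yy n y)) z ((hYd _).comp z (yy n).differentiableAt),
      fderiv_comp_clm (yy n) (YY n X) z (hYd _)]
  have e1 : ∀ μ w, fderiv ℝ (fun y => (X y).1 μ) z w =
      fderiv ℝ (YY n X) (yy n z) (yy n w) μ.succ := by
    intro μ w
    rw [← hYk]
    simp [yy_apply]
  have e2 : ∀ w, fderiv ℝ (fun y => (X y).2.1 0) z w =
      fderiv ℝ (YY n X) (yy n z) (yy n w) 0 := by
    intro w
    rw [← hYk]
    simp [yy_apply]
  have e3 : ∀ μ w, fderiv ℝ (fun y => f0 y μ) z w =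
      fderiv ℝ (fun y => f y μ) (yy n z) (yy n w) := by
    intro μ w
    simp only [hf0]
    rw [fderiv_comp_clm (yy n) (fun y => f y μ) z
      ((contDiff_pi.1 hf μ).differentiable (by simp) _)]
  have e4 : ∀ k, fderiv ℝ (YY n X) (yy n z) (pp n z) k =
      z.2.2.2 * fderiv ℝ (YY n X) (yy n z) (Pi.single 0 1) k -
      ∑ ν : Fin (n+2), z.2.2.1 0 ν * fderiv ℝ (YY n X) (yy n z) (Pi.single ν.succ 1) k := by
    intro k
    have hx : pp n z = ∑ k, pp n z k • (Pi.single k (1:ℝ) : EE n) := by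
      ext k; simp [Finset.sum_apply, Pi.single_apply]
    conv_lhs => rw [hx]
    rw [Fin.sum_univ_succ]
    simp [map_sum, Finset.sum_apply, pp_apply, sub_eq_add_neg]
  have e5 : dv n (YY n X) (yy n z) = fderiv ℝ (YY n X) (yy n z) (Pi.single 0 1) 0 +
      ∑ ν : Fin (n+2), fderiv ℝ (YY n X) (yy n z) (Pi.single ν.succ 1) ν.succ := by
    rw [dv, Fin.sum_univ_succ]
  simp only [pdq, pdx, e1, e2, e3, yy_ex, yy_eq]
  rw [funext_iff, Fin.forall_fin_succ, and_comm]
  refine and_congr (forall_congr' fun μ => ?_) ?_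
  · simp only [Pi.add_apply, Pi.sub_apply, Pi.smul_apply, smul_eq_mul, e4, e5, FF, Fin.cons_succ]
    simp only [pp_apply, Fin.cons_succ]
    constructor <;> intro h <;> linarith
  · simp only [Pi.add_apply, Pi.sub_apply, Pi.smul_apply, smul_eq_mul, e4, e5, FF, Fin.cons_zero]
    simp only [pp_apply, Fin.cons_zero]
    constructor <;> intro h <;> linarith

end MPS

open MPS in
/-- classification in the case `N = 1` (one field component, coordinate
`q = q^0`): `X` is locally hamiltonian for `ω` iff `X^μ` and `X^q` are independent of
`(p^κ, p)` and there exist smooth functions `f_0^μ(x,q)` with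
`X_{p^μ} = − p ∂X^μ/∂q − p^μ ∂X^q/∂q + p^ν ∂X^μ/∂x^ν − p^μ ∂X^ν/∂x^ν + ∂f_0^μ/∂q` and
`X_0 = − p ∂X^μ/∂x^μ − p^μ ∂X^q/∂x^μ + ∂f_0^μ/∂x^μ`; in particular `X^μ` may
depend on `q`. -/
theorem locHam_classification_N1 (n : ℕ)
    (X : Pt n 1 → Pt n 1) (hX : ContDiff ℝ (⊤ : ℕ∞) X) :
    (∀ (z : Pt n 1) (v : Fin (n+3) → Pt n 1), lieD n 1 X (omega n 1) z v = 0) ↔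
      ((∀ z w : Pt n 1, z.1 = w.1 → z.2.1 = w.2.1 →
          (X z).1 = (X w).1 ∧ (X z).2.1 = (X w).2.1) ∧
       ∃ f0 : Pt n 1 → Fin (n+2) → ℝ, ContDiff ℝ (⊤ : ℕ∞) f0 ∧
         (∀ z w : Pt n 1, z.1 = w.1 → z.2.1 = w.2.1 → f0 z = f0 w) ∧
         (∀ (z : Pt n 1) (μ : Fin (n+2)),
           (X z).2.2.1 0 μ =
             - z.2.2.2 * pdq n 1 (fun y => (X y).1 μ) z 0
             - z.2.2.1 0 μ * pdq n 1 (fun y => (X y).2.1 0) z 0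
             + (∑ ν : Fin (n+2), z.2.2.1 0 ν * pdx n 1 (fun y => (X y).1 μ) z ν)
             - z.2.2.1 0 μ * (∑ ν : Fin (n+2), pdx n 1 (fun y => (X y).1 ν) z ν)
             + pdq n 1 (fun y => f0 y μ) z 0) ∧
         (∀ z : Pt n 1,
           (X z).2.2.2 =
             - z.2.2.2 * (∑ μ : Fin (n+2), pdx n 1 (fun y => (X y).1 μ) z μ)
             - (∑ μ : Fin (n+2), z.2.2.1 0 μ * pdx n 1 (fun y => (X y).2.1 0) z μ)
             + (∑ μ : Fin (n+2), pdx n 1 (fun y => f0 y μ) z μ))) := by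
  rw [lieD_iff n X (hX.differentiable (by simp)), indep_iff]
  constructor
  · intro h
    obtain ⟨hY, f, hf, hP⟩ := cond_forward n X hX h
    have hF := fun z => (formula_iff n X hX hY f hf (fun y => f (yy n y)) (fun _ => rfl) z).1 (hP z)
    refine ⟨hY, fun y => f (yy n y), hf.comp (yy n).contDiff, ?_, fun z => (hF z).1,
      fun z => (hF z).2⟩
    intro z w h1 h2
    simp only [(yy_ext n z w).2 ⟨h1, h2⟩]
  · rintro ⟨hY, f0, hf0, hi, h1, h2⟩
    have hf : ContDiff ℝ (⊤ : ℕ∞) (fun s => f0 (iy n s)) := hf0.comp (iy n).contDiff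
    have hff : ∀ z, f0 z = f0 (iy n (yy n z)) := by
      intro z
      have h3 := (yy_ext n z (iy n (yy n z))).1 (by simp)
      exact hi _ _ h3.1 h3.2
    exact cond_backward n X hX hY _ hf fun z =>
      (formula_iff n X hX hY _ hf f0 hff z).2 ⟨h1 z, h2 z⟩
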